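/- Let K be an algebraically closed field of characteristic zero, n ≥ 2 and d ≥ 3. Then F_3 = x_0^{d−2}(x_0x_1 + x_2^2 + ⋯ + x_n^2) ∈ K[x_0,...,x_n] satisfies rk(F_3) = prk(F_3) = (d−1)n + 1. -/

import Mathlib

open MvPolynomial

/-- Apply the iterated partial-derivative operator `∏ i, (∂/∂xᵢ)^(d i)` to `F`. -/
noncomputable def diffOp {K : Type*} [CommSemiring K] {m : ℕ} (d : Fin m →₀ ℕ)
    (F : MvPolynomial (Fin m) K) : MvPolynomial (Fin m) K :=
  (List.finRange m).foldr (fun i G => (⇑(MvPolynomial.pderiv i))^[d i] G) F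

/-- Apolarity action: apply the differential polynomial `δ` (in the dual variables)
to the polynomial `F`. -/
noncomputable def applyDiff {K : Type*} [CommSemiring K] {m : ℕ}
    (δ F : MvPolynomial (Fin m) K) : MvPolynomial (Fin m) K :=
  δ.support.sum fun d => δ.coeff d • diffOp d F

/-- `IsWaringDecomp F d r`: the degree-`d` form `F` lies in the linear span of the
`d`-th powers of `r` linear forms. -/
def IsWaringDecomp {K : Type*} [Field K] {m : ℕ} (F : MvPolynomial (Fin m) K)
    (d r : ℕ) : Prop :=
  ∃ ℓ : Fin r → MvPolynomial (Fin m) K,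
    (∀ j, (ℓ j).IsHomogeneous 1) ∧
    F ∈ Submodule.span K (Set.range fun j => ℓ j ^ d)

/-- The symmetric (Waring) rank of a degree-`d` form. -/
noncomputable def waringRank {K : Type*} [Field K] {m : ℕ}
    (F : MvPolynomial (Fin m) K) (d : ℕ) : ℕ :=
  sInf {r | IsWaringDecomp F d r}

/-- `IsPartialDecomp F d r`: all first partial derivatives of the degree-`d` form `F`
lie simultaneously in the span of the `(d-1)`-st powers of `r` linear forms. -/
def IsPartialDecomp {K : Type*} [Field K] {m : ℕ} (F : MvPolynomial (Fin m) K)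
    (d r : ℕ) : Prop :=
  ∃ t : Fin r → MvPolynomial (Fin m) K,
    (∀ j, (t j).IsHomogeneous 1) ∧
    ∀ i : Fin m, (MvPolynomial.pderiv i F) ∈
      Submodule.span K (Set.range fun j => t j ^ (d - 1))

/-- The partially symmetric rank of a degree-`d` form. -/
noncomputable def pWaringRank {K : Type*} [Field K] {m : ℕ}
    (F : MvPolynomial (Fin m) K) (d : ℕ) : ℕ :=
  sInf {r | IsPartialDecomp F d r}

namespace MvPolynomial

section LowerBound

variable {K : Type*} [Field K] {n : ℕ} {ι : Type*}

/-- The linear form `∑ i, c i * X i`. -/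
noncomputable def linForm (c : Fin (n + 1) → K) : MvPolynomial (Fin (n + 1)) K :=
  ∑ i, C (c i) * X i

/-- The directional derivative `∑ i, a i * ∂/∂xᵢ`. -/
noncomputable def dirDeriv (a : Fin (n + 1) → K) :
    Derivation K (MvPolynomial (Fin (n + 1)) K) (MvPolynomial (Fin (n + 1)) K) :=
  mkDerivation K fun i => C (a i)

@[simp]
lemma dirDeriv_X (a : Fin (n + 1) → K) (i : Fin (n + 1)) : dirDeriv a (X i) = C (a i) :=
  mkDerivation_X K _ _

lemma dirDeriv_single (i : Fin (n + 1)) : dirDeriv (Pi.single i 1 : Fin (n + 1) → K) = pderiv i :=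
  derivation_ext fun j => by
    rw [dirDeriv_X, pderiv_X]
    rcases eq_or_ne j i with rfl | h <;> simp_all

lemma dirDeriv_comm (a b : Fin (n + 1) → K) (p : MvPolynomial (Fin (n + 1)) K) :
    dirDeriv a (dirDeriv b p) = dirDeriv b (dirDeriv a p) := by
  have h : ⁅dirDeriv a, dirDeriv b⁆ = 0 :=
    derivation_ext fun i => by simp [Derivation.commutator_apply]
  rw [← sub_eq_zero, ← Derivation.commutator_apply, h, Derivation.zero_apply]

lemma dirDeriv_linForm (a c : Fin (n + 1) → K) : dirDeriv a (linForm c) = C (a ⬝ᵥ c) := by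
  simp [linForm, dotProduct, Derivation.leibniz, mul_comm]

lemma linForm_add (a c : Fin (n + 1) → K) : linForm (a + c) = linForm a + linForm c := by
  simp [linForm, add_mul, Finset.sum_add_distrib]

lemma linForm_smul (r : K) (c : Fin (n + 1) → K) : linForm (r • c) = C r * linForm c := by
  simp [linForm, Finset.mul_sum, mul_assoc]

lemma linForm_single (i : Fin (n + 1)) : linForm (Pi.single i 1 : Fin (n + 1) → K) = X i := by
  rw [linForm, Finset.sum_eq_single i] <;> simp +contextual

lemma IsHomogeneous.exists_eq_linForm {t : MvPolynomial (Fin (n + 1)) K}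
    (ht : t.IsHomogeneous 1) : ∃ c, t = linForm c := by
  rw [← mem_homogeneousSubmodule, homogeneousSubmodule_one_eq_span_X,
    Submodule.mem_span_range_iff_exists_fun] at ht
  obtain ⟨c, rfl⟩ := ht
  exact ⟨c, by simp [linForm, smul_eq_C_mul]⟩

/-- The quadratic form `x₂² + ⋯ + xₙ²`. -/
noncomputable def tailQuadric (K : Type*) [Field K] (n : ℕ) : MvPolynomial (Fin (n + 1)) K :=
  ∑ i ∈ Finset.univ.filter (fun i : Fin (n + 1) => 2 ≤ (i : ℕ)), X i ^ 2

lemma dirDeriv_tailQuadric (a : Fin (n + 1) → K) :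
    dirDeriv a (tailQuadric K n) =
      linForm fun i : Fin (n + 1) => if 2 ≤ (i : ℕ) then 2 * a i else 0 := by
  simp only [tailQuadric, linForm, map_sum, Finset.sum_filter]
  refine Finset.sum_congr rfl fun i _ => ?_
  split_ifs
  · simp only [Derivation.leibniz_pow, dirDeriv_X, smul_eq_mul, nsmul_eq_mul, map_mul]
    rw [show (C 2 : MvPolynomial (Fin (n + 1)) K) = 2 from map_ofNat C 2]
    push_cast
    ring
  · simp

/-- The form `x₀^(e+1) m + b x₀^e (x₂² + ⋯ + xₙ²)`, where `m` is a linear form. -/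
noncomputable def tangentForm (m : Fin (n + 1) → K) (b : K) (e : ℕ) :
    MvPolynomial (Fin (n + 1)) K :=
  X 0 ^ (e + 1) * linForm m + C b * X 0 ^ e * tailQuadric K n

lemma dirDeriv_tangentForm (a m : Fin (n + 1) → K) (b : K) (e : ℕ) :
    dirDeriv a (tangentForm m b e) =
      X 0 ^ e * linForm (((e + 1) * a 0) • m + (a ⬝ᵥ m) • Pi.single 0 1 +
        b • fun i : Fin (n + 1) => if 2 ≤ (i : ℕ) then 2 * a i else 0) +
      C (b * e * a 0) * X 0 ^ (e - 1) * tailQuadric K n := by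
  simp only [tangentForm, map_add, Derivation.leibniz, Derivation.leibniz_pow, dirDeriv_X,
    dirDeriv_linForm, dirDeriv_tailQuadric, linForm_add, linForm_smul, linForm_single, smul_eq_mul,
    nsmul_eq_mul, derivation_C, map_mul, map_natCast, map_one, Nat.add_sub_cancel]
  push_cast
  ring

lemma dirDeriv_tangentForm_succ (a m : Fin (n + 1) → K) (b : K) (e : ℕ) :
    dirDeriv a (tangentForm m b (e + 1)) =
      tangentForm ((((e + 1 : ℕ) + 1) * a 0) • m + (a ⬝ᵥ m) • Pi.single 0 1 +
        b • fun i : Fin (n + 1) => if 2 ≤ (i : ℕ) then 2 * a i else 0)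
        (b * (e + 1 : ℕ) * a 0) e := by
  rw [dirDeriv_tangentForm, Nat.add_sub_cancel, tangentForm]

/-- The partial derivatives of `tangentForm m b e` are linearly independent. -/
lemma eq_zero_of_dirDeriv_pderiv_tangentForm [CharZero K] (hn : 1 ≤ n) {m : Fin (n + 1) → K}
    (hm : m 1 ≠ 0) {b : K} (hb : b ≠ 0) (e : ℕ) {a : Fin (n + 1) → K}
    (h : ∀ i, dirDeriv a (pderiv i (tangentForm m b e)) = 0) : a = 0 := by
  have h' : ∀ i, pderiv i (dirDeriv a (tangentForm m b e)) = 0 := fun i => by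
    rw [← dirDeriv_single, dirDeriv_comm, dirDeriv_single, h]
  have one_val : ((1 : Fin (n + 1)) : ℕ) = 1 := by
    rw [Fin.val_one', Nat.mod_eq_of_lt (by lia)]
  have one_ne : (1 : Fin (n + 1)) ≠ 0 := fun h => by simp [h] at one_val
  have mod_one : 1 % (n + 1) = 1 := Nat.mod_eq_of_lt (by lia)
  have e_ne : (e + 1 : MvPolynomial (Fin (n + 1)) K) ≠ 0 := by exact_mod_cast e.succ_ne_zero
  simp only [← dirDeriv_single, dirDeriv_tangentForm, map_add, Derivation.leibniz,
    Derivation.leibniz_pow, dirDeriv_X, dirDeriv_linForm, dirDeriv_tailQuadric] at h'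
  have ha0 : a 0 = 0 := by
    have hq : (fun i : Fin (n + 1) =>
        if 2 ≤ (i : ℕ) then 2 * (Pi.single 1 1 : Fin (n + 1) → K) i else 0) = 0 := by
      funext i
      rcases eq_or_ne i 1 with rfl | hi
      · simp only [one_val]
        simp
      · simp [hi]
    have lin0 : linForm (0 : Fin (n + 1) → K) = 0 := by simp [linForm]
    have := h' 1
    rw [hq, lin0] at this
    have : (e + 1 : MvPolynomial (Fin (n + 1)) K) = 0 ∨ a 0 = 0 := by
      simpa [one_ne, mod_one, hm, X_ne_zero] using this
    exact this.resolve_left e_ne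
  have ha2 : ∀ i : Fin (n + 1), 2 ≤ (i : ℕ) → a i = 0 := fun i hi => by
    have hi0 : i ≠ 0 := fun h => by simp [h] at hi
    have := h' i
    simpa [ha0, hi, hi0, hb, X_ne_zero] using this
  have hlin : (fun i : Fin (n + 1) => if 2 ≤ (i : ℕ) then 2 * a i else 0) = 0 :=
    by
    funext i
    by_cases hi : 2 ≤ (i : ℕ) <;> simp [hi, ha2]
  have ham : a ⬝ᵥ m = a 1 * m 1 := Finset.sum_eq_single 1
    (fun i _ hi => by
      rcases Nat.lt_or_ge i 2 with h2 | h2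
      · obtain rfl : i = 0 := by
          rw [Ne, Fin.ext_iff, one_val] at hi
          exact Fin.ext (by simp; lia)
        simp [ha0]
      · simp [ha2 i h2]) (by simp)
  have ha1 : a 1 = 0 := by
    have := h' 0
    rw [hlin, ham] at this
    simp only [ha0, smul_zero, mul_zero, zero_smul, zero_add, add_zero, linForm_smul,
      linForm_single, map_zero, zero_mul, dotProduct_smul, single_dotProduct, Pi.single_eq_same,
      map_one, mul_one, smul_eq_mul, nsmul_eq_mul] at this
    replace this : (C ((e + 1) * (a 1 * m 1)) : MvPolynomial (Fin (n + 1)) K) * X 0 ^ e = 0 := by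
      rw [← this]
      rcases e with _ | e
      · simp
      · simp only [map_mul, map_add, map_natCast, map_one, Nat.add_sub_cancel]
        push_cast
        ring
    have : (e + 1 : MvPolynomial (Fin (n + 1)) K) = 0 ∨ a 1 = 0 := by
      simpa [hm, X_ne_zero] using this
    exact this.resolve_left e_ne
  funext i
  rcases Nat.lt_or_ge i 2 with h2 | h2
  · have : i = 0 ∨ i = 1 := by
      simp only [Fin.ext_iff, one_val, Fin.val_zero]
      lia
    rcases this with rfl | rfl <;> simp [*]
  · exact ha2 i h2

lemma exists_dotProduct_eq_zero_of_span_eq_top {s : Finset ι} {c : ι → Fin (n + 1) → K}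
    (hs : Submodule.span K (c '' s) = ⊤) :
    ∃ a : Fin (n + 1) → K, a 0 ≠ 0 ∧ ∃ t ⊆ s, t.card = n ∧ ∀ j ∈ t, a ⬝ᵥ c j = 0 := by
  classical
  obtain ⟨B, hBs, -, hspan, hli⟩ :=
    exists_linearIndepOn_extension (K := K) (v := c) (linearIndepOn_empty K c)
      (Set.empty_subset (s : Set ι))
  have htop : ⊤ ≤ Submodule.span K (Set.range fun j : B => c j) := by
    rw [← hs, Submodule.span_le, ← Set.image_eq_range]
    exact hspan
  lift B to Finset ι using s.finite_toSet.subset hBs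
  let β := Module.Basis.mk hli htop
  have hcard : B.card = n + 1 := by
    have := Module.finrank_eq_card_basis β
    simpa using this.symm
  obtain ⟨j, hj⟩ : ∃ j, β.coord j (Pi.single 0 1) ≠ 0 := by
    by_contra! h
    have : (Pi.single 0 1 : Fin (n + 1) → K) = 0 := β.forall_coord_eq_zero_iff.1 h
    simpa using congrFun this 0
  refine ⟨fun i => β.coord j (Pi.single i 1), hj, B.erase j,
    (B.erase_subset _).trans (by exact_mod_cast hBs), by simp [hcard], fun k hk => ?_⟩
  have hkB := Finset.mem_of_mem_erase hk
  have : c k = β ⟨k, hkB⟩ := by simp [β]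
  have hdot : ∀ v : Fin (n + 1) → K,
      (fun i => β.coord j (Pi.single i 1)) ⬝ᵥ v = β.coord j v := fun v => by
    conv_rhs => rw [pi_eq_sum_univ' v]
    simp [dotProduct, mul_comm]
  rw [hdot, this, Module.Basis.coord_apply, Module.Basis.repr_self, Finsupp.single_eq_of_ne]
  rintro rfl
  simp at hk

lemma dirDeriv_mem_span {s t : Finset ι} {c : ι → Fin (n + 1) → K} {a : Fin (n + 1) → K} {e : ℕ}
    (h : ∀ j ∈ s, j ∉ t → a ⬝ᵥ c j = 0) {p : MvPolynomial (Fin (n + 1)) K}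
    (hp : p ∈ Submodule.span K ((fun j => linForm (c j) ^ (e + 1)) '' s)) :
    dirDeriv a p ∈ Submodule.span K ((fun j => linForm (c j) ^ e) '' t) := by
  suffices Submodule.span K ((fun j => linForm (c j) ^ (e + 1)) '' s) ≤
      (Submodule.span K ((fun j => linForm (c j) ^ e) '' t)).comap (dirDeriv a).toLinearMap from
    this hp
  rw [Submodule.span_le]
  rintro _ ⟨j, hj, rfl⟩
  have hD : dirDeriv a (linForm (c j) ^ (e + 1)) =
      ((e + 1 : K) * a ⬝ᵥ c j) • linForm (c j) ^ e := by
    rw [Derivation.leibniz_pow, dirDeriv_linForm, smul_eq_C_mul]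
    simp only [Nat.add_sub_cancel, smul_eq_mul, nsmul_eq_mul, map_mul, map_add, map_natCast,
      map_one]
    push_cast
    ring
  change dirDeriv a (linForm (c j) ^ (e + 1)) ∈ Submodule.span K _
  rw [hD]
  by_cases hjt : j ∈ t
  · exact Submodule.smul_mem _ _ (Submodule.subset_span ⟨j, hjt, rfl⟩)
  · simp [h j hj hjt]

lemma span_eq_top_of_pderiv_tangentForm_mem [CharZero K] (hn : 1 ≤ n) {m : Fin (n + 1) → K}
    (hm : m 1 ≠ 0) {b : K} (hb : b ≠ 0) {e : ℕ} {s : Finset ι} {c : ι → Fin (n + 1) → K}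
    (h : ∀ i, pderiv i (tangentForm m b e) ∈
      Submodule.span K ((fun j => linForm (c j) ^ (e + 1)) '' s)) :
    Submodule.span K (c '' s) = ⊤ := by
  by_contra hne
  obtain ⟨f, hf, hle⟩ := Submodule.exists_le_ker_of_lt_top _ (lt_top_iff_ne_top.2 hne)
  obtain ⟨a, rfl⟩ := (dotProductEquiv K (Fin (n + 1))).surjective f
  refine hf ?_
  rw [eq_zero_of_dirDeriv_pderiv_tangentForm hn hm hb e (a := a) fun i => ?_, map_zero]
  have := dirDeriv_mem_span (t := ∅) (a := a)
    (fun j hj _ => hle (Submodule.subset_span ⟨j, hj, rfl⟩)) (h i)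
  simpa using this

theorem le_card_of_pderiv_tangentForm_mem [CharZero K] (hn : 1 ≤ n) (c : ι → Fin (n + 1) → K)
    (e : ℕ) : ∀ {m : Fin (n + 1) → K}, m 1 ≠ 0 → ∀ {b : K}, b ≠ 0 → ∀ {s : Finset ι},
    (∀ i, pderiv i (tangentForm m b e) ∈
      Submodule.span K ((fun j => linForm (c j) ^ (e + 1)) '' s)) →
    (e + 1) * n + 1 ≤ s.card := by
  classical
  induction e with
  | zero =>
    intro m hm b hb s h
    have htop := span_eq_top_of_pderiv_tangentForm_mem hn hm hb h
    have := finrank_span_finset_le_card (R := K) (s.image c)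
    rw [Finset.coe_image, Set.finrank, htop, finrank_top, Module.finrank_fin_fun] at this
    have := this.trans Finset.card_image_le
    lia
  | succ e ih =>
    intro m hm b hb s h
    have htop := span_eq_top_of_pderiv_tangentForm_mem hn hm hb h
    obtain ⟨a, ha, t, hts, htc, hat⟩ := exists_dotProduct_eq_zero_of_span_eq_top htop
    have one_val : ((1 : Fin (n + 1)) : ℕ) = 1 := by
      rw [Fin.val_one', Nat.mod_eq_of_lt (by lia)]
    have one_ne : (1 : Fin (n + 1)) ≠ 0 := fun h => by simp [h] at one_val
    have e_ne : ((e + 1 : ℕ) : K) ≠ 0 := by exact_mod_cast e.succ_ne_zero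
    have e_ne' : ((e + 1 : ℕ) + 1 : K) ≠ 0 := by exact_mod_cast (e + 1).succ_ne_zero
    have := ih (m := (((e + 1 : ℕ) + 1) * a 0) • m + (a ⬝ᵥ m) • Pi.single 0 1 +
        b • fun i : Fin (n + 1) => if 2 ≤ (i : ℕ) then 2 * a i else 0)
      (by
        have mod_one : 1 % (n + 1) = 1 := Nat.mod_eq_of_lt (by lia)
        have : (((e + 1 : ℕ) + 1) * a 0) * m 1 ≠ 0 := mul_ne_zero (mul_ne_zero e_ne' ha) hm
        simpa [one_ne, mod_one] using this)
      (b := b * (e + 1 : ℕ) * a 0) (mul_ne_zero (mul_ne_zero hb e_ne) ha)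
      (s := s \ t) fun i => by
        rw [← dirDeriv_tangentForm_succ, ← dirDeriv_single, dirDeriv_comm, dirDeriv_single]
        exact dirDeriv_mem_span (fun j hj hj' => hat j (by
          by_contra hjt
          exact hj' (Finset.mem_sdiff.2 ⟨hj, hjt⟩))) (h i)
    rw [Finset.card_sdiff_of_subset hts, htc] at this
    lia

end LowerBound

end MvPolynomial

section UpperBound

variable {K : Type*} [Field K]

lemma IsPrimitiveRoot.sum_pow_mul_eq_ite {N : ℕ} {ζ : K} (hζ : IsPrimitiveRoot ζ N) (i : ℕ) :
    ∑ k ∈ Finset.range N, ζ ^ (k * i) = if N ∣ i then (N : K) else 0 := by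
  simp_rw [mul_comm _ i, pow_mul]
  split_ifs with h
  · simp [(hζ.pow_eq_one_iff_dvd i).2 h]
  · have hne : ζ ^ i - 1 ≠ 0 := sub_ne_zero.2 fun h' => h ((hζ.pow_eq_one_iff_dvd i).1 h')
    refine (mul_eq_zero.1 (geom_sum_mul (ζ ^ i) N ▸ ?_ :
      (∑ k ∈ Finset.range N, (ζ ^ i) ^ k) * (ζ ^ i - 1) = 0)).resolve_right hne
    rw [← pow_mul, mul_comm, pow_mul, hζ.pow_eq_one, one_pow, sub_self]

/-- Averaging `(x + ζᵏ y)^d` over the powers of a root of unity `ζ` selects the terms of the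
binomial expansion in a residue class. -/
lemma IsPrimitiveRoot.sum_smul_add_smul_pow {A : Type*} [CommRing A] [Algebra K A] {N : ℕ} {ζ : K}
    (hζ : IsPrimitiveRoot ζ N) (x y : A) (s d : ℕ) :
    ∑ k ∈ Finset.range N, ζ ^ (k * s) • (x + ζ ^ k • y) ^ d =
      ∑ i ∈ Finset.range (d + 1),
        if N ∣ s + i then ((N : K) * d.choose i) • (x ^ (d - i) * y ^ i) else 0 := by
  have h : ∀ k, ζ ^ (k * s) • (x + ζ ^ k • y) ^ d = ∑ i ∈ Finset.range (d + 1),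
      (ζ ^ (k * (s + i)) * d.choose i) • (x ^ (d - i) * y ^ i) := fun k => by
    rw [add_comm, add_pow, Finset.smul_sum]
    refine Finset.sum_congr rfl fun i _ => ?_
    rw [smul_pow, mul_add, pow_add, pow_mul ζ k i]
    simp only [Algebra.smul_def, map_mul, map_natCast]
    ring
  simp_rw [h]
  rw [Finset.sum_comm]
  refine Finset.sum_congr rfl fun i _ => ?_
  rw [← Finset.sum_smul, ← Finset.sum_mul, hζ.sum_pow_mul_eq_ite]
  split_ifs <;> simp

variable [CharZero K] {A : Type*} [CommRing A] [Algebra K A]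

lemma IsPrimitiveRoot.pow_mul_mem_span {d : ℕ} (hd : 2 ≤ d) {ζ : K} (hζ : IsPrimitiveRoot ζ d)
    (x y : A) :
    x ^ (d - 1) * y ∈ Submodule.span K (Set.range fun k : Fin d => (x + ζ ^ (k : ℕ) • y) ^ d) := by
  have h := hζ.sum_smul_add_smul_pow x y (d - 1) d
  rw [Finset.sum_eq_single_of_mem (s := Finset.range (d + 1)) 1 (by simp; lia),
    if_pos (by rw [Nat.sub_add_cancel (by lia)]),
    Nat.choose_one_right, pow_one] at h
  · have hd0 : (d : K) * d ≠ 0 := by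
      have : (d : K) ≠ 0 := by exact_mod_cast (by lia : d ≠ 0)
      exact mul_ne_zero this this
    rw [← (Submodule.span K _).smul_mem_iff hd0, ← h]
    exact Submodule.sum_mem _ fun k hk => Submodule.smul_mem _ _ <|
      Submodule.subset_span ⟨⟨k, Finset.mem_range.1 hk⟩, rfl⟩
  · intro i hi hi1
    refine if_neg fun ⟨q, hq⟩ => ?_
    rw [Finset.mem_range] at hi
    have h1 : 1 ≤ q := by
      by_contra hq0
      obtain rfl : q = 0 := by lia
      lia
    have h2 : q < 2 := by
      by_contra hq2
      have : d * 2 ≤ d * q := Nat.mul_le_mul_left _ (by lia)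
      lia
    obtain rfl : q = 1 := by lia
    lia

lemma IsPrimitiveRoot.pow_mul_sq_add_mem_span {d : ℕ} (hd : 3 ≤ d) {ζ : K}
    (hζ : IsPrimitiveRoot ζ (d - 1)) (x y : A) :
    x ^ (d - 2) * y ^ 2 + (if d = 3 then 3⁻¹ else 0 : K) • x ^ d ∈
      Submodule.span K (Set.range fun k : Fin (d - 1) => (x + ζ ^ (k : ℕ) • y) ^ d) := by
  have h := hζ.sum_smul_add_smul_pow x y (d - 3) d
  have hc0 : ((d - 1 : ℕ) : K) * d.choose 2 ≠ 0 :=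
    mul_ne_zero (by exact_mod_cast (by lia : d - 1 ≠ 0))
      (by exact_mod_cast (Nat.choose_pos (by lia)).ne')
  have hsum : ∑ i ∈ Finset.range (d + 1), (if d - 1 ∣ d - 3 + i then
        (((d - 1 : ℕ) : K) * d.choose i) • (x ^ (d - i) * y ^ i) else 0) =
      (((d - 1 : ℕ) : K) * d.choose 2) •
        (x ^ (d - 2) * y ^ 2 + (if d = 3 then 3⁻¹ else 0 : K) • x ^ d) := by
    rw [Finset.sum_eq_add_of_mem 2 0 (by simp; lia) (by simp) (by simp), if_pos ⟨1, by lia⟩,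
      smul_add]
    · congr 1
      by_cases h3 : d = 3
      · subst h3
        simp [smul_smul]
      · have : ¬ d - 1 ∣ d - 3 + 0 := Nat.not_dvd_of_pos_of_lt (by lia) (by lia)
        rw [if_neg this, if_neg h3, zero_smul, smul_zero]
    · intro i hi hi'
      refine if_neg fun ⟨q, hq⟩ => ?_
      rw [Finset.mem_range] at hi
      have h1 : q ≠ 0 := by
        rintro rfl
        lia
      have h2 : q < 2 := by
        by_contra hq2
        have : (d - 1) * 2 ≤ (d - 1) * q := Nat.mul_le_mul_left _ (by lia)
        lia
      obtain rfl : q = 1 := by lia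
      lia
  rw [hsum] at h
  rw [← (Submodule.span K _).smul_mem_iff hc0, ← h]
  exact Submodule.sum_mem _ fun k hk => Submodule.smul_mem _ _ <|
    Submodule.subset_span ⟨⟨k, Finset.mem_range.1 hk⟩, rfl⟩

end UpperBound

lemma isWaringDecomp_card {K : Type*} [Field K] {m d : ℕ} {F : MvPolynomial (Fin m) K}
    {ι : Type*} [Fintype ι] (ℓ : ι → MvPolynomial (Fin m) K) (hℓ : ∀ j, (ℓ j).IsHomogeneous 1)
    (hF : F ∈ Submodule.span K (Set.range fun j => ℓ j ^ d)) :
    IsWaringDecomp F d (Fintype.card ι) := by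
  refine ⟨ℓ ∘ (Fintype.equivFin ι).symm, fun j => hℓ _, ?_⟩
  rwa [← (Fintype.equivFin ι).symm.surjective.range_comp] at hF

lemma IsWaringDecomp.isPartialDecomp {K : Type*} [Field K] {m d r : ℕ}
    {F : MvPolynomial (Fin m) K} (h : IsWaringDecomp F d r) : IsPartialDecomp F d r := by
  obtain ⟨ℓ, hℓ, hF⟩ := h
  refine ⟨ℓ, hℓ, fun i => ?_⟩
  suffices Submodule.span K (Set.range fun j => ℓ j ^ d) ≤
      (Submodule.span K (Set.range fun j => ℓ j ^ (d - 1))).comap (pderiv i).toLinearMap from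
    this hF
  rw [Submodule.span_le]
  rintro _ ⟨j, rfl⟩
  obtain ⟨c, hc⟩ : ∃ c, pderiv i (ℓ j) = C c :=
    ⟨_, totalDegree_eq_zero_iff_eq_C.1 (by
      have := (hℓ j).pderiv (i := i)
      exact Nat.le_zero.1 this.totalDegree_le)⟩
  change pderiv i (ℓ j ^ d) ∈ Submodule.span K _
  have : pderiv i (ℓ j ^ d) = ((d : K) * c) • ℓ j ^ (d - 1) := by
    rw [Derivation.leibniz_pow, hc, smul_eq_C_mul]
    simp only [smul_eq_mul, nsmul_eq_mul, map_mul, map_natCast]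
    ring
  rw [this]
  exact Submodule.smul_mem _ _ (Submodule.subset_span ⟨j, rfl⟩)

lemma isWaringDecomp_tangentForm {K : Type*} [Field K] [IsAlgClosed K] [CharZero K] {n d : ℕ}
    (hn : 1 ≤ n) (hd : 3 ≤ d) :
    IsWaringDecomp ((X 0) ^ (d - 2) *
        (X 0 * X 1 +
          ∑ i ∈ Finset.univ.filter (fun i : Fin (n + 1) => 2 ≤ (i : ℕ)), X i ^ 2) :
        MvPolynomial (Fin (n + 1)) K) d ((d - 1) * n + 1) := by
  have : NeZero (d : K) := ⟨by exact_mod_cast (by lia : d ≠ 0)⟩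
  have : NeZero ((d - 1 : ℕ) : K) := ⟨by exact_mod_cast (by lia : d - 1 ≠ 0)⟩
  obtain ⟨ζ, hζ⟩ := HasEnoughRootsOfUnity.exists_primitiveRoot K d
  obtain ⟨ξ, hξ⟩ := HasEnoughRootsOfUnity.exists_primitiveRoot K (d - 1)
  let S := Finset.univ.filter (fun i : Fin (n + 1) => 2 ≤ (i : ℕ))
  have hS : S.card = n - 1 := by
    have : S = Finset.univ.filter (fun i : Fin (n + 1) => ¬ (i : ℕ) < 2)  := by
      simp only [S, not_lt]
    rw [this, Finset.filter_not, Finset.card_sdiff_of_subset (Finset.filter_subset _ _),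
      Fin.card_filter_val_lt]
    simp
    lia
  let μ : K := if d = 3 then 3⁻¹ else 0
  let z : MvPolynomial (Fin (n + 1)) K := X 1 - ((S.card : K) * μ) • X 0
  let ℓ : Fin d ⊕ (S × Fin (d - 1)) → MvPolynomial (Fin (n + 1)) K :=
    Sum.elim (fun k => X 0 + ζ ^ (k : ℕ) • z) fun p => X 0 + ξ ^ (p.2 : ℕ) • X p.1.1
  have hcard : Fintype.card (Fin d ⊕ (S × Fin (d - 1))) = (d - 1) * n + 1 := by
    simp only [Fintype.card_sum, Fintype.card_prod, Fintype.card_fin, Fintype.card_coe, hS]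
    obtain ⟨n, rfl⟩ := Nat.exists_eq_add_of_le' hn
    obtain ⟨d, rfl⟩ := Nat.exists_eq_add_of_le' hd
    simp only [Nat.add_sub_cancel, show d + 3 - 1 = d + 2 by lia]
    ring
  rw [← hcard]
  have homog : ∀ (r : K) {p : MvPolynomial (Fin (n + 1)) K}, p.IsHomogeneous 1 →
      (r • p).IsHomogeneous 1 := fun r p hp =>
    (homogeneousSubmodule (Fin (n + 1)) K 1).smul_mem r hp
  have hz : z.IsHomogeneous 1 := (isHomogeneous_X K 1).sub (homog _ (isHomogeneous_X K 0))
  refine isWaringDecomp_card ℓ ?_ ?_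
  · rintro (k | p)
    · exact (isHomogeneous_X K 0).add (homog _ hz)
    · exact (isHomogeneous_X K 0).add (homog _ (isHomogeneous_X K _))
  · have key : (X 0 ^ (d - 2) * (X 0 * X 1 + ∑ i ∈ S, X i ^ 2) : MvPolynomial (Fin (n + 1)) K) =
        X 0 ^ (d - 1) * z + ∑ i ∈ S, (X 0 ^ (d - 2) * X i ^ 2 + μ • X 0 ^ d) := by
      obtain ⟨d, rfl⟩ := Nat.exists_eq_add_of_le' hd
      rw [Finset.sum_add_distrib, ← Finset.mul_sum, Finset.sum_const]
      simp only [z, smul_eq_C_mul, nsmul_eq_mul, map_mul, map_natCast,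
        show d + 3 - 1 = d + 2 by lia, show d + 3 - 2 = d + 1 by lia]
      ring
    rw [key]
    refine Submodule.add_mem _ ?_ (Submodule.sum_mem _ fun i hi => ?_)
    · refine Submodule.span_mono ?_ (hζ.pow_mul_mem_span (by lia) _ _)
      rintro _ ⟨k, rfl⟩
      exact ⟨Sum.inl k, rfl⟩
    · refine Submodule.span_mono ?_ (hξ.pow_mul_sq_add_mem_span hd _ _)
      rintro _ ⟨k, rfl⟩
      exact ⟨Sum.inr (⟨i, hi⟩, k), rfl⟩

lemma IsPartialDecomp.le_of_tangentForm {K : Type*} [Field K] [CharZero K] {n d r : ℕ}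
    (hn : 1 ≤ n) (hd : 2 ≤ d)
    (h : IsPartialDecomp ((X 0) ^ (d - 2) *
        (X 0 * X 1 +
          ∑ i ∈ Finset.univ.filter (fun i : Fin (n + 1) => 2 ≤ (i : ℕ)), X i ^ 2) :
        MvPolynomial (Fin (n + 1)) K) d r) : (d - 1) * n + 1 ≤ r := by
  obtain ⟨e, rfl⟩ := Nat.exists_eq_add_of_le' hd
  obtain ⟨t, ht, h⟩ := h
  choose c hc using fun j => (ht j).exists_eq_linForm
  have hF : X 0 ^ e * (X 0 * X 1 +
      ∑ i ∈ Finset.univ.filter (fun i : Fin (n + 1) => 2 ≤ (i : ℕ)), X i ^ 2) =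
      tangentForm (Pi.single 1 1 : Fin (n + 1) → K) 1 e := by
    rw [tangentForm, linForm_single, tailQuadric, map_one]
    ring
  simp only [Nat.add_sub_cancel, hF, hc, show e + 2 - 1 = e + 1 by lia] at h ⊢
  have := le_card_of_pderiv_tangentForm_mem hn c e (m := Pi.single 1 1) (by simp)
    (one_ne_zero (α := K)) (s := Finset.univ) (by simpa using h)
  simpa using this

/-- For `n ≥ 2`, `d ≥ 3`, the form
`F₃ = x₀^{d−2}(x₀x₁ + x₂² + ⋯ + x_n²)` satisfies `rk(F₃) = prk(F₃) = (d−1)n + 1`. -/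
theorem stmt9 (K : Type*) [Field K] [IsAlgClosed K] [CharZero K] (n d : ℕ)
    (hn : 2 ≤ n) (hd : 3 ≤ d) :
    waringRank ((X 0) ^ (d - 2) *
        (X 0 * X 1 +
          ∑ i ∈ Finset.univ.filter (fun i : Fin (n + 1) => 2 ≤ (i : ℕ)), X i ^ 2) :
        MvPolynomial (Fin (n + 1)) K) d = (d - 1) * n + 1 ∧
    pWaringRank ((X 0) ^ (d - 2) *
        (X 0 * X 1 +
          ∑ i ∈ Finset.univ.filter (fun i : Fin (n + 1) => 2 ≤ (i : ℕ)), X i ^ 2) :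
        MvPolynomial (Fin (n + 1)) K) d = (d - 1) * n + 1 := by
  have hup := isWaringDecomp_tangentForm (K := K) (by lia : 1 ≤ n) hd
  refine ⟨le_antisymm (Nat.sInf_le hup) (le_csInf ⟨_, hup⟩ fun r hr => ?_),
    le_antisymm (Nat.sInf_le hup.isPartialDecomp)
      (le_csInf ⟨_, hup.isPartialDecomp⟩ fun r hr => ?_)⟩
  · exact hr.isPartialDecomp.le_of_tangentForm (by lia) (by lia)
  · exact hr.le_of_tangentForm (by lia) (by lia)
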